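/- Factorisation of SK-combinators is not representable in Combinatory Logic: there is no CL-term G such that, for all CL-terms M, N: G A M N →*_CL M whenever A is S or K, and G (P Q) M N →*_CL N P Q whenever P Q is a compound factorable form (i.e. one of S X, K X, S X Y). -/

import Mathlib

/-- Terms of Combinatory Logic (SK-calculus). -/
inductive CL where
  | S : CL
  | K : CL
  | app : CL → CL → CL

/-- One-step reduction of Combinatory Logic, closed under contexts. -/
inductive CL.Red : CL → CL → Prop
  | sred (M N X : CL) :
      CL.Red (app (app (app S M) N) X) (app (app M X) (app N X))
  | kred (M N : CL) : CL.Red (app (app K M) N) M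
  | appL {M M' : CL} (N : CL) : CL.Red M M' → CL.Red (app M N) (app M' N)
  | appR (M : CL) {N N' : CL} : CL.Red N N' → CL.Red (app M N) (app M N')

/-- Compound factorable forms of Combinatory Logic: `S X`, `K X`, `S X Y`. -/
def CL.CompoundFactorable : CL → Prop
  | .app .S _ => True
  | .app .K _ => True
  | .app (.app .S _) _ => True
  | _ => False

/-- Tokens of the Engeler graph model: an atom, or a step function `l ↦ b`
with finite argument `l` and value `b`. -/
inductive Token where
  | atom : Token
  | arr : List Token → Token → Token

namespace Token

/-- The set of tokens occurring in a list. -/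
def ofList (l : List Token) : Set Token := {t | t ∈ l}

/-- Application in the graph model. -/
def ap (x y : Set Token) : Set Token := {b | ∃ l, arr l b ∈ x ∧ ofList l ⊆ y}

/-- The interpretation of `K`. -/
def kSet : Set Token := fun
  | arr l (arr _ b) => b ∈ l
  | _ => False

/-- The interpretation of `S`. -/
def sSet : Set Token := fun
  | arr l (arr m (arr n b)) => b ∈ ap (ap (ofList l) (ofList n)) (ap (ofList m) (ofList n))
  | _ => False

theorem arr_mem_kSet {l m : List Token} {b : Token} : arr l (arr m b) ∈ kSet ↔ b ∈ l := Iff.rfl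

theorem arr_mem_sSet {l m n : List Token} {b : Token} :
    arr l (arr m (arr n b)) ∈ sSet ↔
      b ∈ ap (ap (ofList l) (ofList n)) (ap (ofList m) (ofList n)) := Iff.rfl

theorem ap_mono {x x' y y' : Set Token} (hx : x ⊆ x') (hy : y ⊆ y') : ap x y ⊆ ap x' y' :=
  fun _ ⟨l, hl, hs⟩ => ⟨l, hx hl, hs.trans hy⟩

theorem ofList_append (l m : List Token) : ofList (l ++ m) = ofList l ∪ ofList m := by
  ext t
  simp [ofList]

theorem arr_mem_ap_kSet {x : Set Token} {m : List Token} {b : Token} :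
    arr m b ∈ ap kSet x ↔ b ∈ x := by
  constructor
  · rintro ⟨l, hl, hs⟩
    exact hs (arr_mem_kSet.1 hl)
  · intro hb
    refine ⟨[b], arr_mem_kSet.2 (by simp), ?_⟩
    simpa [ofList] using hb

theorem ap_ap_kSet (x y : Set Token) : ap (ap kSet x) y = x := by
  ext b
  constructor
  · rintro ⟨m, hm, -⟩
    exact arr_mem_ap_kSet.1 hm
  · intro hb
    exact ⟨[], arr_mem_ap_kSet.2 hb, by simp [ofList]⟩

/-- A finite part of `ap y z` is already produced by finite parts of `y` and `z`. -/
theorem exists_finite_support {y z : Set Token} (p : List Token) (hp : ofList p ⊆ ap y z) :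
    ∃ m n, ofList m ⊆ y ∧ ofList n ⊆ z ∧ ofList p ⊆ ap (ofList m) (ofList n) := by
  induction p with
  | nil => exact ⟨[], [], by simp [ofList], by simp [ofList], by simp [ofList]⟩
  | cons c p ih =>
    obtain ⟨m, n, hm, hn, hmn⟩ := ih fun t ht => hp (List.mem_cons_of_mem c ht)
    obtain ⟨r, hr, hrz⟩ := hp (show c ∈ ofList (c :: p) from List.mem_cons_self)
    refine ⟨arr r c :: m, r ++ n, ?_, ?_, ?_⟩
    · rintro t (_ | ⟨_, ht⟩)
      exacts [hr, hm ht]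
    · rw [ofList_append]
      exact Set.union_subset hrz hn
    · rw [ofList_append]
      rintro t (_ | ⟨_, ht⟩)
      · exact ⟨r, List.mem_cons_self, Set.subset_union_left⟩
      · exact ap_mono (fun _ => List.mem_cons_of_mem _) Set.subset_union_right (hmn ht)

theorem arr_mem_ap_ap_sSet {x y : Set Token} {n : List Token} {b : Token} :
    arr n b ∈ ap (ap sSet x) y ↔ b ∈ ap (ap x (ofList n)) (ap y (ofList n)) := by
  constructor
  · rintro ⟨m, ⟨l, hl, hlx⟩, hmy⟩
    exact ap_mono (ap_mono hlx subset_rfl) (ap_mono hmy subset_rfl) (arr_mem_sSet.1 hl)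
  · rintro ⟨p, ⟨q, hq, hqn⟩, hp⟩
    obtain ⟨m, n', hm, hn', hmn⟩ := exists_finite_support p hp
    refine ⟨m, ⟨[arr q (arr p b)], arr_mem_sSet.2 ⟨p, ⟨q, List.mem_cons_self, hqn⟩,
      hmn.trans (ap_mono subset_rfl hn')⟩, ?_⟩, hm⟩
    simpa [ofList] using hq

theorem ap_ap_ap_sSet (x y z : Set Token) :
    ap (ap (ap sSet x) y) z = ap (ap x z) (ap y z) := by
  ext b
  constructor
  · rintro ⟨n, hn, hnz⟩
    exact ap_mono (ap_mono subset_rfl hnz) (ap_mono subset_rfl hnz) (arr_mem_ap_ap_sSet.1 hn)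
  · rintro ⟨p, ⟨q, hq, hqz⟩, hp⟩
    obtain ⟨m, n, hm, hn, hmn⟩ := exists_finite_support p hp
    refine ⟨q ++ n, arr_mem_ap_ap_sSet.2 ⟨p, ⟨q, hq, ?_⟩, ?_⟩, ?_⟩
    · rw [ofList_append]
      exact Set.subset_union_left
    · rw [ofList_append]
      exact hmn.trans (ap_mono hm Set.subset_union_right)
    · rw [ofList_append]
      exact Set.union_subset hqz hn

theorem ap_ap_sSet_kSet (x y : Set Token) :
    ap (ap sSet kSet) x = ap (ap sSet kSet) y := by
  have not_atom : ∀ z, atom ∉ ap (ap sSet kSet) z := fun z ⟨_, ⟨_, h, _⟩, _⟩ => h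
  ext t
  cases t with
  | atom => exact iff_of_false (not_atom x) (not_atom y)
  | arr n b => simp only [arr_mem_ap_ap_sSet, ap_ap_kSet]

theorem kSet_ne_sSet : kSet ≠ sSet := by
  intro h
  have hk : arr [atom] (arr [] atom) ∈ kSet := arr_mem_kSet.2 List.mem_cons_self
  rw [h] at hk
  exact hk

end Token

namespace CL

/-- Interpretation of combinators in the graph model. -/
def denote : CL → Set Token
  | S => Token.sSet
  | K => Token.kSet
  | app M N => Token.ap M.denote N.denote

theorem Red.denote_eq {M N : CL} (h : Red M N) : M.denote = N.denote := by
  induction h with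
  | sred M N X => exact Token.ap_ap_ap_sSet _ _ _
  | kred M N => exact Token.ap_ap_kSet _ _
  | appL N _ ih => simp only [denote, ih]
  | appR M _ ih => simp only [denote, ih]

theorem denote_eq_of_reflTransGen {M N : CL} (h : Relation.ReflTransGen Red M N) :
    M.denote = N.denote := by
  induction h with
  | refl => rfl
  | tail _ h ih => exact ih.trans h.denote_eq

end CL

/-- Factorisation of SK-combinators is not representable in Combinatory Logic:
there is no CL-term `G` such that `G A M N →*_CL M` whenever `A` is `S` or `K`,
and `G (P Q) M N →*_CL N P Q` whenever `P Q` is a compound factorable form. -/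
theorem no_factorisation_in_CL :
    ¬ ∃ G : CL,
        (∀ M N : CL,
          Relation.ReflTransGen CL.Red (CL.app (CL.app (CL.app G CL.S) M) N) M ∧
          Relation.ReflTransGen CL.Red (CL.app (CL.app (CL.app G CL.K) M) N) M) ∧
        (∀ P Q M N : CL, (CL.app P Q).CompoundFactorable →
          Relation.ReflTransGen CL.Red
            (CL.app (CL.app (CL.app G (CL.app P Q)) M) N)
            (CL.app (CL.app N P) Q)) := by
  rintro ⟨G, -, hG⟩
  have key : ∀ X : CL,
      Token.ap (Token.ap (Token.ap G.denote (Token.ap (Token.ap Token.sSet Token.kSet) X.denote))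
        Token.sSet) (Token.ap Token.kSet (Token.ap (Token.ap Token.sSet Token.kSet) Token.kSet)) =
      X.denote := by
    intro X
    have h := CL.denote_eq_of_reflTransGen
      (hG (.app .S .K) X .S (.app .K (.app (.app .S .K) .K)) trivial)
    simpa only [CL.denote, Token.ap_ap_kSet, Token.ap_ap_ap_sSet] using h
  have hK := key .K
  rw [Token.ap_ap_sSet_kSet (CL.denote .K) (CL.denote .S), key .S] at hK
  exact Token.kSet_ne_sSet hK.symm
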